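/- The quotient algebra A = ΛV/I is a Poincaré duality algebra of dimension 2. Precisely: (i) the quotient map q : ΛV → A is injective on ℚ ⊕ V (the degree 0 and degree 1 parts); (ii) Λ^kV ⊆ I for every k ≥ 3; (iii) the image q(Λ²V) is one-dimensional over ℚ; (iv) the induced pairing V × V → q(Λ²V) ≅ ℚ, (u,v) ↦ q(u∧v), is nondegenerate (it is induced by ω). In particular dim_ℚ A = 2g + 2. -/

import Mathlib

noncomputable section

open ExteriorAlgebra in
/-- The map `ΛV → ℚ × V × ℚ` recording the degree `0` part, the degree `1` part, and the value of
`c` on the degree `2` part. -/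
def lowDegree {V : Type} [AddCommGroup V] [Module ℚ V] (c : ExteriorAlgebra ℚ V →ₗ[ℚ] ℚ) :
    ExteriorAlgebra ℚ V →ₗ[ℚ] ℚ × V × ℚ :=
  let proj := GradedAlgebra.proj (fun n : ℕ => ⋀[ℚ]^n V)
  (algebraMapInv.toLinearMap ∘ₗ proj 0).prod ((ιInv ∘ₗ proj 1).prod (c ∘ₗ proj 2))

section

open ExteriorAlgebra

variable {V : Type} [AddCommGroup V] [Module ℚ V] (c : ExteriorAlgebra ℚ V →ₗ[ℚ] ℚ)

theorem lowDegree_algebraMap (r : ℚ) :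
    lowDegree c (algebraMap ℚ (ExteriorAlgebra ℚ V) r) = (r, 0, 0) := by
  have h : algebraMap ℚ (ExteriorAlgebra ℚ V) r ∈ ⋀[ℚ]^0 V := by
    simp [exteriorPower, Submodule.mem_one]
  simp [lowDegree, GradedAlgebra.proj_apply, -DirectSum.decompose_algebraMap,
    DirectSum.decompose_of_mem_same (fun n : ℕ => ⋀[ℚ]^n V) h,
    DirectSum.decompose_of_mem_ne (fun n : ℕ => ⋀[ℚ]^n V) h zero_ne_one,
    DirectSum.decompose_of_mem_ne (fun n : ℕ => ⋀[ℚ]^n V) h (show 0 ≠ 2 by simp)]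

theorem lowDegree_ι (v : V) : lowDegree c (ι ℚ v) = (0, v, 0) := by
  have h : ι ℚ v ∈ ⋀[ℚ]^1 V := by simp [exteriorPower]
  simp [lowDegree, GradedAlgebra.proj_apply,
    DirectSum.decompose_of_mem_same (fun n : ℕ => ⋀[ℚ]^n V) h,
    DirectSum.decompose_of_mem_ne (fun n : ℕ => ⋀[ℚ]^n V) h one_ne_zero,
    DirectSum.decompose_of_mem_ne (fun n : ℕ => ⋀[ℚ]^n V) h (show 1 ≠ 2 by simp)]
  exact ι_leftInverse v

theorem lowDegree_of_mem_two {z : ExteriorAlgebra ℚ V} (h : z ∈ ⋀[ℚ]^2 V) :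
    lowDegree c z = (0, 0, c z) := by
  simp [lowDegree, GradedAlgebra.proj_apply,
    DirectSum.decompose_of_mem_same (fun n : ℕ => ⋀[ℚ]^n V) h,
    DirectSum.decompose_of_mem_ne (fun n : ℕ => ⋀[ℚ]^n V) h two_ne_zero,
    DirectSum.decompose_of_mem_ne (fun n : ℕ => ⋀[ℚ]^n V) h (show 2 ≠ 1 by simp)]

theorem lowDegree_of_mem_of_three_le {k : ℕ} (hk : 3 ≤ k) {z : ExteriorAlgebra ℚ V}
    (h : z ∈ ⋀[ℚ]^k V) : lowDegree c z = 0 := by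
  simp [lowDegree, GradedAlgebra.proj_apply,
    DirectSum.decompose_of_mem_ne (fun n : ℕ => ⋀[ℚ]^n V) h (show k ≠ 0 by lia),
    DirectSum.decompose_of_mem_ne (fun n : ℕ => ⋀[ℚ]^n V) h (show k ≠ 1 by lia),
    DirectSum.decompose_of_mem_ne (fun n : ℕ => ⋀[ℚ]^n V) h (show k ≠ 2 by lia)]

theorem ι_mul_ι_mem (u v : V) : ι ℚ u * ι ℚ v ∈ ⋀[ℚ]^2 V := by
  rw [exteriorPower, pow_two]
  exact Submodule.mul_mem_mul ⟨u, rfl⟩ ⟨v, rfl⟩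

theorem lowDegree_mul_mul {z : ExteriorAlgebra ℚ V} (hz : z ∈ ⋀[ℚ]^2 V) (hcz : c z = 0)
    (a b : ExteriorAlgebra ℚ V) : lowDegree c (a * z * b) = 0 := by
  induction a using DirectSum.Decomposition.inductionOn (fun n : ℕ => ⋀[ℚ]^n V) with
  | zero => simp
  | add a a' ha ha' => simp [add_mul, ha, ha']
  | @homogeneous i a =>
    induction b using DirectSum.Decomposition.inductionOn (fun n : ℕ => ⋀[ℚ]^n V) with
    | zero => simp
    | add b b' hb hb' => simp [mul_add, hb, hb']
    | @homogeneous j b =>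
      have h : (a * z * b : ExteriorAlgebra ℚ V) ∈ ⋀[ℚ]^(i + 2 + j) V :=
        SetLike.mul_mem_graded (SetLike.mul_mem_graded a.2 hz) b.2
      by_cases hij : 3 ≤ i + 2 + j
      · exact lowDegree_of_mem_of_three_le c hij h
      · obtain ⟨rfl, rfl⟩ : i = 0 ∧ j = 0 := by lia
        obtain ⟨r, hr⟩ := Submodule.mem_one.1 (by simpa [exteriorPower] using a.2)
        obtain ⟨s, hs⟩ := Submodule.mem_one.1 (by simpa [exteriorPower] using b.2)
        rw [lowDegree_of_mem_two c h, ← hr, ← hs, ← Algebra.commutes s, ← Algebra.smul_def,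
          ← Algebra.smul_def]
        simp [hcz]

theorem lowDegree_surjective {e f : V} (hef : c (ι ℚ e * ι ℚ f) = 1) :
    Function.Surjective (lowDegree c) := by
  rintro ⟨r, v, s⟩
  refine ⟨algebraMap ℚ _ r + ι ℚ v + s • (ι ℚ e * ι ℚ f), ?_⟩
  simp [lowDegree_algebraMap, lowDegree_ι, lowDegree_of_mem_two c (ι_mul_ι_mem e f), hef]

/-- The two-sided ideal of `ΛV` generated by `Λ²V ∩ ker c`. -/
def kernelIdeal : Submodule ℚ (ExteriorAlgebra ℚ V) :=
  Submodule.span ℚ {x | ∃ a b z : ExteriorAlgebra ℚ V,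
    z ∈ (LinearMap.range (ι ℚ (M := V))) ^ 2 ∧ c z = 0 ∧ x = a * z * b}

variable {c}

theorem mul_mul_mem_kernelIdeal {z : ExteriorAlgebra ℚ V} (hz : z ∈ ⋀[ℚ]^2 V) (hcz : c z = 0)
    (a b : ExteriorAlgebra ℚ V) : a * z * b ∈ kernelIdeal c :=
  Submodule.subset_span ⟨a, b, z, hz, hcz, rfl⟩

theorem kernelIdeal_mul_mem {x : ExteriorAlgebra ℚ V} (hx : x ∈ kernelIdeal c)
    (y : ExteriorAlgebra ℚ V) : x * y ∈ kernelIdeal c := by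
  induction hx using Submodule.span_induction with
  | mem x h =>
    obtain ⟨a, b, z, hz, hcz, rfl⟩ := h
    rw [mul_assoc]
    exact mul_mul_mem_kernelIdeal hz hcz a (b * y)
  | zero => simp
  | add x x' _ _ h h' => simpa [add_mul] using add_mem h h'
  | smul r x _ h => simpa using Submodule.smul_mem _ r h

theorem ι_mul_ι_mul_ι_mem_kernelIdeal {e f : V} (hef : c (ι ℚ e * ι ℚ f) = 1) (u v w : V) :
    ι ℚ u * ι ℚ v * ι ℚ w ∈ kernelIdeal c := by
  have sub_mem (x y : V) :
      ι ℚ x * ι ℚ y - c (ι ℚ x * ι ℚ y) • (ι ℚ e * ι ℚ f) ∈ ⋀[ℚ]^2 V :=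
    sub_mem (ι_mul_ι_mem x y) (Submodule.smul_mem _ _ (ι_mul_ι_mem e f))
  have c_sub (x y : V) : c (ι ℚ x * ι ℚ y - c (ι ℚ x * ι ℚ y) • (ι ℚ e * ι ℚ f)) = 0 := by
    simp [hef]
  have anti : ι ℚ f * ι ℚ e = -(ι ℚ e * ι ℚ f) := eq_neg_of_add_eq_zero_left (ι_add_mul_swap f e)
  have hfe : ι ℚ f * (ι ℚ e * ι ℚ f) = 0 := by
    rw [← mul_assoc, anti, neg_mul, mul_assoc, ι_sq_zero, mul_zero, neg_zero]
  have hfew : ι ℚ f * ι ℚ e * ι ℚ w ∈ kernelIdeal c := by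
    simpa [mul_sub, hfe, mul_assoc] using mul_mul_mem_kernelIdeal (sub_mem e w) (c_sub e w) (ι ℚ f) 1
  have hefw : ι ℚ e * ι ℚ f * ι ℚ w ∈ kernelIdeal c := by
    simpa [anti] using hfew
  have huvw := mul_mul_mem_kernelIdeal (sub_mem u v) (c_sub u v) 1 (ι ℚ w)
  rw [one_mul, sub_mul, smul_mul_assoc] at huvw
  exact (Submodule.sub_mem_iff_left _ (Submodule.smul_mem _ _ hefw)).1 huvw

open scoped Pointwise in
theorem exteriorPower_le_kernelIdeal {e f : V} (hef : c (ι ℚ e * ι ℚ f) = 1) {k : ℕ}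
    (hk : 3 ≤ k) : ⋀[ℚ]^k V ≤ kernelIdeal c := by
  have h3 : ⋀[ℚ]^3 V ≤ kernelIdeal c := by
    have h : (LinearMap.range (ι ℚ (M := V))) ^ 3 =
        Submodule.span ℚ (Set.range (ι ℚ (M := V)) * Set.range (ι ℚ (M := V)) *
          Set.range (ι ℚ (M := V))) := by
      rw [← Submodule.span_mul_span, ← Submodule.span_mul_span, ← LinearMap.coe_range,
        Submodule.span_eq, pow_succ, pow_two]
    rw [exteriorPower, h, Submodule.span_le]
    rintro _ ⟨_, ⟨_, ⟨u, rfl⟩, _, ⟨v, rfl⟩, rfl⟩, _, ⟨w, rfl⟩, rfl⟩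
    exact ι_mul_ι_mul_ι_mem_kernelIdeal hef u v w
  obtain ⟨m, rfl⟩ := Nat.exists_eq_add_of_le hk
  rw [exteriorPower, pow_add, Submodule.mul_le]
  exact fun x hx y _ => kernelIdeal_mul_mem (h3 hx) y

theorem ker_lowDegree {e f : V} (hef : c (ι ℚ e * ι ℚ f) = 1) :
    LinearMap.ker (lowDegree c) = kernelIdeal c := by
  apply le_antisymm
  · intro x hx
    obtain ⟨h0, h1, h2⟩ : algebraMapInv (DirectSum.decompose (fun n : ℕ => ⋀[ℚ]^n V) x 0).1 = 0 ∧
        ιInv (DirectSum.decompose (fun n : ℕ => ⋀[ℚ]^n V) x 1).1 = 0 ∧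
        c (DirectSum.decompose (fun n : ℕ => ⋀[ℚ]^n V) x 2).1 = 0 := by
      simpa [lowDegree, GradedAlgebra.proj_apply] using hx
    classical
    rw [← DirectSum.sum_support_decompose (fun n : ℕ => ⋀[ℚ]^n V) x]
    refine sum_mem fun k _ => ?_
    have hmem := (DirectSum.decompose (fun n : ℕ => ⋀[ℚ]^n V) x k).2
    match k with
    | 0 =>
      obtain ⟨r, hr⟩ := Submodule.mem_one.1 (by simpa [exteriorPower] using hmem)
      rw [← hr, algebraMap_leftInverse] at h0
      simp [← hr, h0]
    | 1 =>
      obtain ⟨v, hv⟩ := by simpa [exteriorPower] using hmem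
      rw [← hv, ι_leftInverse] at h1
      simp [← hv, h1]
    | 2 => simpa using mul_mul_mem_kernelIdeal hmem h2 1 1
    | k + 3 => exact exteriorPower_le_kernelIdeal hef (by lia) hmem
  · refine Submodule.span_le.2 ?_
    rintro _ ⟨a, b, z, hz, hcz, rfl⟩
    exact lowDegree_mul_mul c hz hcz a b

end

/-- let `V` be a `2g`-dimensional `ℚ`-vector space with a
nondegenerate alternating form `ω`, let `c : ΛV → ℚ` be the linear map with
`c(u∧v) = ω(u,v)` on `Λ²V`, and let `I` be the two-sided ideal of `ΛV`
generated by `ker c ∩ Λ²V`.  Then `A = ΛV/I` is a Poincaré duality algebra of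
dimension `2`:  (i) the quotient map `q` is injective on `ℚ ⊕ V`;
(ii) `Λ^k V ⊆ I` for `k ≥ 3`; (iii) `q(Λ²V)` is one-dimensional;
(iv) the pairing `(u,v) ↦ q(u∧v)` is nondegenerate;  and `dim_ℚ A = 2g + 2`. -/
theorem stmt_9 (g : ℕ) (hg : 1 ≤ g)
    (V : Type) [AddCommGroup V] [Module ℚ V] [FiniteDimensional ℚ V]
    (hdim : Module.finrank ℚ V = 2 * g)
    (ω : LinearMap.BilinForm ℚ V) (halt : ∀ v : V, ω v v = 0)
    (hnd : ω.Nondegenerate)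
    (c : ExteriorAlgebra ℚ V →ₗ[ℚ] ℚ)
    (hc : ∀ u v : V, c (ExteriorAlgebra.ι ℚ u * ExteriorAlgebra.ι ℚ v) = ω u v)
    (I : Submodule ℚ (ExteriorAlgebra ℚ V))
    (hI : I = Submodule.span ℚ
      {x : ExteriorAlgebra ℚ V | ∃ a b z : ExteriorAlgebra ℚ V,
        z ∈ (LinearMap.range (ExteriorAlgebra.ι ℚ (M := V))) ^ 2 ∧ c z = 0 ∧
        x = a * z * b}) :
    (∀ (r : ℚ) (v : V),
        Submodule.Quotient.mk (p := I) (algebraMap ℚ (ExteriorAlgebra ℚ V) r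
          + ExteriorAlgebra.ι ℚ v) = 0 → r = 0 ∧ v = 0) ∧
    (∀ k : ℕ, 3 ≤ k →
      ∀ z ∈ (LinearMap.range (ExteriorAlgebra.ι ℚ (M := V))) ^ k,
        Submodule.Quotient.mk (p := I) z = 0) ∧
    (Module.finrank ℚ
      (Submodule.map I.mkQ
        ((LinearMap.range (ExteriorAlgebra.ι ℚ (M := V))) ^ 2)) = 1) ∧
    (∀ u : V, u ≠ 0 → ∃ v : V,
      Submodule.Quotient.mk (p := I)
        (ExteriorAlgebra.ι ℚ u * ExteriorAlgebra.ι ℚ v) ≠ 0) ∧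
    Module.finrank ℚ (ExteriorAlgebra ℚ V ⧸ I) = 2 * g + 2 := by
  have hV : 0 < Module.finrank ℚ V := by lia
  obtain ⟨e, he⟩ := Module.finrank_pos_iff_exists_ne_zero.1 hV
  have exists_ne (u : V) (hu : u ≠ 0) : ∃ v, ω u v ≠ 0 := by
    by_contra! h
    exact hu (hnd.1 u h)
  obtain ⟨f, hf⟩ := exists_ne e he
  have hef : c (ExteriorAlgebra.ι ℚ e * ExteriorAlgebra.ι ℚ ((ω e f)⁻¹ • f)) = 1 := by
    simp [hc, hf]
  generalize (ω e f)⁻¹ • f = f' at hef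
  have hker : I = LinearMap.ker (lowDegree c) := hI.trans (ker_lowDegree hef).symm
  have mk_eq_zero (x : ExteriorAlgebra ℚ V) :
      Submodule.Quotient.mk (p := I) x = 0 ↔ lowDegree c x = 0 := by
    rw [Submodule.Quotient.mk_eq_zero, hker, LinearMap.mem_ker]
  refine ⟨fun r v h => ?_, fun k hk z hz => ?_, ?_, fun u hu => ?_, ?_⟩
  · rw [mk_eq_zero, map_add, lowDegree_algebraMap, lowDegree_ι] at h
    simpa using h
  · exact (mk_eq_zero z).2 (lowDegree_of_mem_of_three_le c hk hz)
  · have hmk : Submodule.map I.mkQ (⋀[ℚ]^2 V) = ℚ ∙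
        I.mkQ (ExteriorAlgebra.ι ℚ e * ExteriorAlgebra.ι ℚ f') := by
      apply le_antisymm
      · rintro _ ⟨z, hz, rfl⟩
        refine Submodule.mem_span_singleton.2 ⟨c z, ?_⟩
        rw [← map_smul, ← sub_eq_zero, ← map_sub, Submodule.mkQ_apply, mk_eq_zero, map_sub,
          map_smul, lowDegree_of_mem_two c hz, lowDegree_of_mem_two c (ι_mul_ι_mem e f'), hef]
        simp
      · rw [Submodule.span_singleton_le_iff_mem]
        exact Submodule.mem_map_of_mem (ι_mul_ι_mem e f')
    refine (congrArg (fun S : Submodule ℚ _ => Module.finrank ℚ S) hmk).trans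
      (finrank_span_singleton ?_)
    rw [Submodule.mkQ_apply, ne_eq, mk_eq_zero, lowDegree_of_mem_two c (ι_mul_ι_mem e f'), hef]
    simp
  · obtain ⟨v, hv⟩ := exists_ne u hu
    refine ⟨v, ?_⟩
    rw [ne_eq, mk_eq_zero, lowDegree_of_mem_two c (ι_mul_ι_mem u v), hc]
    simpa using hv
  · rw [hker, ((lowDegree c).quotKerEquivOfSurjective (lowDegree_surjective c hef)).finrank_eq]
    simp [hdim]
    lia

end
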